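/- Fix an agenda list Φ of Lambek-calculus formulas and an odd number n ≥ 3 of agents. Φ satisfies the median property (every minimally L-inconsistent sublist of Φ has length at most 2) if and only if for every profile (J_1,…,J_n) of robustly consistent judgment lists over Φ, the majority outcome is robustly consistent. -/

import Mathlib

namespace Stmt7

inductive LForm : Type
  | atom : ℕ → LForm
  | bot  : LForm
  | prod : LForm → LForm → LForm          -- A ⊙ B
  | lDiv : LForm → LForm → LForm          -- A \ B
  | rDiv : LForm → LForm → LForm          -- B / A
  deriving DecidableEq

/-- Sequent derivability Γ ⊢ C in the Lambek calculus (lists, no structural rules). -/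
inductive LDeriv : List LForm → LForm → Prop
  | ax (A) : LDeriv [A] A
  | cut {Γ Δ₁ Δ₂ A C} : LDeriv Γ A → LDeriv (Δ₁ ++ A :: Δ₂) C →
      LDeriv (Δ₁ ++ Γ ++ Δ₂) C
  | prodL {Γ₁ Γ₂ A B C} : LDeriv (Γ₁ ++ A :: B :: Γ₂) C →
      LDeriv (Γ₁ ++ LForm.prod A B :: Γ₂) C
  | prodR {Γ Δ A B} : LDeriv Γ A → LDeriv Δ B → LDeriv (Γ ++ Δ) (LForm.prod A B)
  | lDivL {Γ Δ₁ Δ₂ A B C} : LDeriv Γ A → LDeriv (Δ₁ ++ B :: Δ₂) C →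
      LDeriv (Δ₁ ++ Γ ++ LForm.lDiv A B :: Δ₂) C
  | lDivR {Γ A B} : LDeriv (A :: Γ) B → LDeriv Γ (LForm.lDiv A B)
  | rDivL {Γ Δ₁ Δ₂ A B C} : LDeriv Γ A → LDeriv (Δ₁ ++ B :: Δ₂) C →
      LDeriv (Δ₁ ++ LForm.rDiv B A :: Γ ++ Δ₂) C
  | rDivR {Γ A B} : LDeriv (Γ ++ [A]) B → LDeriv Γ (LForm.rDiv B A)

def LInconsistent (Γ : List LForm) : Prop := LDeriv Γ .bot

def robustlyConsistent (Γ : List LForm) : Prop :=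
  ∀ Δ : List LForm, Δ.Sublist Γ → ¬ LInconsistent Δ

def sublistOf (Φ : List LForm) (J : Finset ℕ) : List LForm :=
  ((List.range Φ.length).filter (fun j => decide (j ∈ J))).map (fun j => Φ.getD j .bot)

def majPos (n : ℕ) (Φ : List LForm) (J : Fin n → Finset ℕ) : Finset ℕ :=
  (Finset.range Φ.length).filter
    (fun j => n < 2 * (Finset.univ.filter (fun i => j ∈ J i)).card)

def majList (n : ℕ) (Φ : List LForm) (J : Fin n → Finset ℕ) : List LForm :=
  sublistOf Φ (majPos n Φ J)

/-- The agenda contains no tautologies and no contradictions. -/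
def isAgenda (Φ : List LForm) : Prop :=
  ∀ φ ∈ Φ, ¬ LDeriv [] φ ∧ ¬ LDeriv [φ] .bot

/-- Y is a minimally L-inconsistent sublist of Φ. -/
def minimallyInconsistent (Y : List LForm) : Prop :=
  LInconsistent Y ∧ ∀ Z : List LForm, Z.Sublist Y → Z ≠ Y → ¬ LInconsistent Z

/-- The median property for a Lambek agenda list. -/
def medianProperty (Φ : List LForm) : Prop :=
  ∀ Y : List LForm, Y.Sublist Φ → minimallyInconsistent Y → Y.length ≤ 2

theorem sublistOf_mono (Φ : List LForm) {S T : Finset ℕ} (h : S ⊆ T) :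
    (sublistOf Φ S).Sublist (sublistOf Φ T) := by
  unfold sublistOf
  apply List.Sublist.map
  apply List.monotone_filter_right
  intro a ha
  simp only [decide_eq_true_eq] at ha ⊢
  exact h ha

theorem sublistOf_range (Φ : List LForm) : sublistOf Φ (Finset.range Φ.length) = Φ := by
  unfold sublistOf
  have : (List.range Φ.length).filter (fun j => decide (j ∈ Finset.range Φ.length))
      = List.range Φ.length := by
    rw [List.filter_eq_self]
    intro a ha
    simpa using ha
  rw [this]
  apply List.ext_getElem
  · simp
  · intro i h1 h2
    simp [h2]

theorem length_sublistOf (Φ : List LForm) (S : Finset ℕ) (hS : S ⊆ Finset.range Φ.length) :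
    (sublistOf Φ S).length = S.card := by
  unfold sublistOf
  rw [List.length_map, ← List.toFinset_card_of_nodup (List.nodup_range.filter _)]
  congr 1
  ext a
  simp only [List.mem_toFinset, List.mem_filter, List.mem_range, decide_eq_true_eq]
  exact ⟨fun h => h.2, fun h => ⟨by simpa using hS h, h⟩⟩

theorem exists_positions (Φ Y : List LForm) (M : Finset ℕ) (h : Y.Sublist (sublistOf Φ M)) :
    ∃ S : Finset ℕ, S ⊆ M ∧ S ⊆ Finset.range Φ.length ∧ Y = sublistOf Φ S := by
  unfold sublistOf at h
  obtain ⟨l, hl, rfl⟩ := List.sublist_map_iff.1 h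
  have hr : l.Sublist (List.range Φ.length) := hl.trans List.filter_sublist
  have hnd : l.Nodup := hr.nodup List.nodup_range
  refine ⟨l.toFinset, ?_, ?_, ?_⟩
  · intro a ha
    have := hl.subset (List.mem_toFinset.1 ha)
    simpa using (List.mem_filter.1 this).2
  · intro a ha
    have := hr.subset (List.mem_toFinset.1 ha)
    simpa using this
  · unfold sublistOf
    congr 1
    have hs := hr.filter (fun j => decide (j ∈ l.toFinset))
    have he : l.filter (fun j => decide (j ∈ l.toFinset)) = l := by
      rw [List.filter_eq_self]
      intro a ha
      simpa using ha
    rw [he] at hs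
    apply hs.eq_of_length
    apply List.Perm.length_eq
    rw [List.perm_ext_iff_of_nodup hnd (List.nodup_range.filter _)]
    intro a
    simp only [List.mem_filter, List.mem_toFinset, decide_eq_true_eq]
    exact ⟨fun h => ⟨hr.subset h, h⟩, fun h => h.2⟩

theorem exists_minimal (k : ℕ) : ∀ Y : List LForm, Y.length ≤ k → LInconsistent Y →
    ∃ Z : List LForm, Z.Sublist Y ∧ minimallyInconsistent Z := by
  induction k with
  | zero =>
    intro Y hk hY
    refine ⟨Y, List.Sublist.refl _, hY, fun Z hZ hne _ => hne (hZ.eq_of_length ?_)⟩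
    have := hZ.length_le
    omega
  | succ k ih =>
    intro Y hk hY
    by_cases h : minimallyInconsistent Y
    · exact ⟨Y, List.Sublist.refl _, h⟩
    · have : ∃ Z : List LForm, Z.Sublist Y ∧ Z ≠ Y ∧ LInconsistent Z := by
        by_contra hc
        exact h ⟨hY, fun Z h1 h2 h3 => hc ⟨Z, h1, h2, h3⟩⟩
      obtain ⟨Z, h1, h2, h3⟩ := this
      have hlt : Z.length < Y.length := by
        rcases Nat.lt_or_ge Z.length Y.length with h | h
        · exact h
        · exact absurd (h1.eq_of_length_le h) h2
      obtain ⟨W, hW, hm⟩ := ih Z (by omega) h3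
      exact ⟨W, hW.trans h1, hm⟩

theorem exists_common (n : ℕ) (A B : Finset (Fin n)) (hA : n < 2 * A.card)
    (hB : n < 2 * B.card) : ∃ i, i ∈ A ∧ i ∈ B := by
  have h1 := Finset.card_union_add_card_inter A B
  have h2 : (A ∪ B).card ≤ n := by simpa using Finset.card_le_univ (A ∪ B)
  have h3 : 0 < (A ∩ B).card := by omega
  obtain ⟨i, hi⟩ := Finset.card_pos.1 h3
  exact ⟨i, Finset.mem_inter.1 hi⟩

/-- If every misser of a position lies in an injective image of `Fin m`, `n = 2m+1`,
the position wins the majority. -/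
theorem majority_of_few_missing (n m : ℕ) (hn : n = 2 * m + 1) (P Q : Fin n → Prop)
    [DecidablePred P] (c : ℕ) (hQ : ∀ i, ¬ Q i → P i)
    (hP : ∀ i, Q i → c ≤ i.val ∧ i.val < c + m) :
    n < 2 * (Finset.univ.filter P).card := by
  classical
  have h1 : (Finset.univ.filter Q).card ≤ m := by
    have : ((Finset.univ.filter Q).map Fin.valEmbedding).card ≤ (Finset.Ico c (c + m)).card := by
      apply Finset.card_le_card
      intro a ha
      simp only [Finset.mem_map, Finset.mem_filter, Finset.mem_univ, true_and] at ha
      obtain ⟨i, hi, rfl⟩ := ha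
      simpa using hP i hi
    simpa using this
  have h2 : (Finset.univ.filter (fun i => ¬ Q i)).card ≤ (Finset.univ.filter P).card := by
    apply Finset.card_le_card
    intro i hi
    simp only [Finset.mem_filter, Finset.mem_univ, true_and] at hi ⊢
    exact hQ i hi
  have h3 := Finset.card_filter_add_card_filter_not (s := (Finset.univ : Finset (Fin n))) Q
  simp only [Finset.card_univ, Fintype.card_fin] at h3
  omega

/-- a Lambek agenda list Φ satisfies the median property iff for every
profile (n odd, n ≥ 3) of robustly consistent judgment lists over Φ, the majority
outcome is robustly consistent. -/
theorem median_property_iff_majority_robustly_consistent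
    (n : ℕ) (hodd : Odd n) (h3 : 3 ≤ n)
    (Φ : List LForm) (hΦ : isAgenda Φ) :
    medianProperty Φ ↔
      ∀ J : Fin n → Finset ℕ,
        (∀ i, J i ⊆ Finset.range Φ.length ∧ robustlyConsistent (sublistOf Φ (J i))) →
        robustlyConsistent (majList n Φ J) := by
  constructor
  · intro hmed J hJ Δ hΔ hinc
    obtain ⟨Y, hYΔ, hY⟩ := exists_minimal Δ.length Δ le_rfl hinc
    have hYm := hYΔ.trans hΔ
    obtain ⟨S, hSM, hSr, rfl⟩ := exists_positions Φ Y _ hYm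
    have hsub : (sublistOf Φ S).Sublist Φ := by
      have := sublistOf_mono Φ hSr
      rwa [sublistOf_range] at this
    have hlen := hmed _ hsub hY
    rw [length_sublistOf Φ S hSr] at hlen
    have key : ∃ i, S ⊆ J i := by
      have hmaj : ∀ a ∈ S, n < 2 * (Finset.univ.filter (fun i => a ∈ J i)).card := by
        intro a ha
        exact (Finset.mem_filter.1 (hSM ha)).2
      have hc : S.card = 0 ∨ S.card = 1 ∨ S.card = 2 := by omega
      rcases hc with hc | hc | hc
      · rw [Finset.card_eq_zero] at hc
        exact ⟨⟨0, by omega⟩, by simp [hc]⟩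
      · obtain ⟨a, rfl⟩ := Finset.card_eq_one.1 hc
        obtain ⟨i, hi, -⟩ := exists_common n _ _ (hmaj a (by simp)) (hmaj a (by simp))
        exact ⟨i, by simpa using hi⟩
      · obtain ⟨a, b, -, rfl⟩ := Finset.card_eq_two.1 hc
        obtain ⟨i, hi, hj⟩ := exists_common n _ _ (hmaj a (by simp)) (hmaj b (by simp))
        refine ⟨i, ?_⟩
        simp only [Finset.mem_filter, Finset.mem_univ, true_and] at hi hj
        intro x hx
        simp only [Finset.mem_insert, Finset.mem_singleton] at hx
        rcases hx with rfl | rfl <;> assumption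
    obtain ⟨i, hi⟩ := key
    exact (hJ i).2 _ (sublistOf_mono Φ hi) hY.1
  · intro hmaj Y hYΦ hY
    by_contra hlen
    obtain ⟨S, -, hSr, rfl⟩ := exists_positions Φ Y (Finset.range Φ.length)
      (by rwa [sublistOf_range])
    rw [length_sublistOf Φ S hSr] at hlen
    obtain ⟨a, ha, b, hb, c, hc, hab, hac, hbc⟩ := Finset.two_lt_card.1 (not_le.1 hlen)
    obtain ⟨m, hm⟩ := hodd
    let f : Fin n → ℕ := fun i => if i.val < m then a else if i.val < 2 * m then b else c
    have hf : ∀ i, f i ∈ S := by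
      intro i
      simp only [f]
      split_ifs <;> assumption
    have hrob := hmaj (fun i => S.erase (f i)) (fun i => by
      refine ⟨(Finset.erase_subset _ _).trans hSr, ?_⟩
      intro Δ hΔ
      apply hY.2 Δ (hΔ.trans (sublistOf_mono Φ (Finset.erase_subset _ _)))
      rintro rfl
      have h1 := hΔ.length_le
      rw [length_sublistOf Φ _ hSr,
        length_sublistOf Φ _ ((Finset.erase_subset _ _).trans hSr)] at h1
      have := Finset.card_erase_lt_of_mem (hf i)
      omega)
    refine hrob _ (sublistOf_mono Φ ?_) hY.1
    intro x hx
    refine Finset.mem_filter.2 ⟨hSr hx, ?_⟩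
    have hst : ∃ s, ∀ i : Fin n, x = f i → s ≤ i.val ∧ i.val < s + m := by
      by_cases hxa : x = a
      · refine ⟨0, fun i hi => ?_⟩
        simp only [f] at hi
        split_ifs at hi <;> grind
      · by_cases hxb : x = b
        · refine ⟨m, fun i hi => ?_⟩
          simp only [f] at hi
          split_ifs at hi <;> grind
        · refine ⟨2 * m, fun i hi => ?_⟩
          have := i.isLt
          simp only [f] at hi
          split_ifs at hi <;> grind
    obtain ⟨s, hs⟩ := hst
    exact majority_of_few_missing n m hm _ (fun i => x = f i) s
      (fun i hi => Finset.mem_erase.2 ⟨hi, hx⟩) hs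

end Stmt7
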